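/- (Decomposition Lemma) For every interpretation I, mechanisms γ1, γ2, and e-predicates P, Q: if I ⊨ {P}γ1;γ2{Q}, then there exists an e-predicate R such that I ⊨ {P}γ1{R} and I ⊨ {R}γ2{Q}; indeed R = wpre(γ2,Q,I) has this property. -/

import Mathlib

open scoped Classical

noncomputable section

namespace MPL

/-- Terms over variables `V` and function symbols `F` (function symbols applied to
a stream of arguments; finite arities are modelled by ignoring superfluous arguments). -/
inductive Term (V F : Type) : Type where
  | var : V → Term V F
  | app : F → (ℕ → Term V F) → Term V F

/-- Boolean expressions over variables `V`, function symbols `F` and relation symbols `R`. -/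
inductive BExp (V F R : Type) : Type where
  | tt : BExp V F R
  | rel : R → (ℕ → Term V F) → BExp V F R
  | not : BExp V F R → BExp V F R
  | and : BExp V F R → BExp V F R → BExp V F R

/-- MPL mechanisms: assignment, sequential composition, conditional, while-loop,
and simultaneous choice `ch_A(X)` for a finite nonempty set `A` of agents with
distinct choice variables `X a` for `a ∈ A`. -/
inductive Mech (Ag V F R : Type) : Type where
  | assign : V → Term V F → Mech Ag V F R
  | seq : Mech Ag V F R → Mech Ag V F R → Mech Ag V F R
  | ite : BExp V F R → Mech Ag V F R → Mech Ag V F R → Mech Ag V F R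
  | wh : BExp V F R → Mech Ag V F R → Mech Ag V F R
  | choice : (A : Finset Ag) → A.Nonempty → (X : Ag → V) → Set.InjOn X ↑A → Mech Ag V F R

/-- An interpretation: a domain, interpretations of the function and relation symbols,
and for every agent a preference preorder on the domain with a uniformly worst element. -/
structure Interp (Ag V F R : Type) : Type 1 where
  D : Type
  funI : F → (ℕ → D) → D
  relI : R → (ℕ → D) → Prop
  /-- `pref a d d'` means `d ≥_a d'`. -/
  pref : Ag → D → D → Prop
  pref_refl : ∀ a d, pref a d d
  pref_trans : ∀ a d1 d2 d3, pref a d1 d2 → pref a d2 d3 → pref a d1 d3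
  worst : D
  worst_least : ∀ a d, pref a d worst

variable {Ag V F R : Type}

/-- A state assigns a domain element to every mechanism variable. -/
abbrev State (I : Interp Ag V F R) : Type := V → I.D

/-- Value of a term in an interpretation at a state. -/
def Term.eval (I : Interp Ag V F R) (s : State I) : Term V F → I.D
  | .var x => s x
  | .app f ts => I.funI f (fun n => (ts n).eval I s)

/-- Truth of a boolean expression in an interpretation at a state. -/
def BExp.holds (I : Interp Ag V F R) (s : State I) : BExp V F R → Prop
  | .tt => True
  | .rel r ts => I.relI r (fun n => (ts n).eval I s)
  | .not b => ¬ b.holds I s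
  | .and b1 b2 => b1.holds I s ∧ b2.holds I s

/-- A configuration: a mechanism (or `none` for the empty mechanism Λ) together with a state. -/
abbrev Cfg (I : Interp Ag V F R) : Type := Option (Mech Ag V F R) × State I

/-- Update a state at one variable. -/
def updState (I : Interp Ag V F R) (s : State I) (x : V) (d : I.D) : State I :=
  fun y => if y = x then d else s y

/-- The structured operational semantics: labelled transitions `⟨γ,s⟩ →_A ⟨γ',s'⟩`. -/
inductive Step (I : Interp Ag V F R) : Cfg I → Set Ag → Cfg I → Prop where
  | assign (x : V) (t : Term V F) (s : State I) :
      Step I (some (.assign x t), s) ∅ (none, updState I s x (t.eval I s))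
  | choice (A : Finset Ag) (hA : A.Nonempty) (X : Ag → V) (hX : Set.InjOn X ↑A)
      (s s' : State I) (hagree : ∀ y : V, (∀ a ∈ A, X a ≠ y) → s' y = s y) :
      Step I (some (.choice A hA X hX), s) ↑A (none, s')
  | seqFin {γ1 γ2 s L s'} : Step I (some γ1, s) L (none, s') →
      Step I (some (.seq γ1 γ2), s) L (some γ2, s')
  | seqStep {γ1 γ2 s L γ1' s'} : Step I (some γ1, s) L (some γ1', s') →
      Step I (some (.seq γ1 γ2), s) L (some (.seq γ1' γ2), s')
  | iteT {B γ1 γ2 s} : B.holds I s → Step I (some (.ite B γ1 γ2), s) ∅ (some γ1, s)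
  | iteF {B γ1 γ2 s} : ¬ B.holds I s → Step I (some (.ite B γ1 γ2), s) ∅ (some γ2, s)
  | whF {B γ s} : ¬ B.holds I s → Step I (some (.wh B γ), s) ∅ (none, s)
  | whT {B γ s} : B.holds I s → Step I (some (.wh B γ), s) ∅ (some (.seq γ (.wh B γ)), s)

/-- A (partial) history of the game rooted at `c0`: a nonempty finite sequence of
configurations starting at `c0` and linked by transitions. -/
def IsHist (I : Interp Ag V F R) (c0 : Cfg I) (h : List (Cfg I)) : Prop :=
  h.head? = some c0 ∧ h.Chain' (fun c c' => ∃ L, Step I c L c')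

/-- A strategy profile: for every agent a strategy assigning a chosen value to each history. -/
abbrev Profile (I : Interp Ag V F R) : Type := Ag → List (Cfg I) → I.D

/-- The state resulting from the agents in `A` choosing values for their variables
`X a` according to the profile `σ` at history `h`. -/
def chooseVal (I : Interp Ag V F R) (A : Finset Ag) (X : Ag → V) (σ : Profile I)
    (h : List (Cfg I)) (s : State I) : State I :=
  fun y => if hy : ∃ a, a ∈ A ∧ X a = y then σ hy.choose h else s y

/-- The successor configuration of a (non-empty) configuration, as determined by the
operational semantics together with the choices prescribed by the profile `σ` at history `h`. -/
def next (I : Interp Ag V F R) (σ : Profile I) (h : List (Cfg I)) :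
    Mech Ag V F R → State I → Cfg I
  | .assign x t, s => (none, updState I s x (t.eval I s))
  | .choice A _ X _, s => (none, chooseVal I A X σ h s)
  | .seq γ1 γ2, s =>
      match next I σ h γ1 s with
      | (none, s') => (some γ2, s')
      | (some γ1', s') => (some (.seq γ1' γ2), s')
  | .ite B γ1 γ2, s => if B.holds I s then (some γ1, s) else (some γ2, s)
  | .wh B γ, s => if B.holds I s then (some (.seq γ (.wh B γ)), s) else (none, s)

/-- Extend a history by one step of play according to `σ` (histories ending in Λ stay put). -/
def extend (I : Interp Ag V F R) (σ : Profile I) (h : List (Cfg I)) : List (Cfg I) :=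
  match h.getLast? with
  | some (some γ, s) => h ++ [next I σ h γ s]
  | _ => h

/-- The history of the unique run determined by profile `σ` from `c0`, after `n` steps. -/
def runH (I : Interp Ag V F R) (c0 : Cfg I) (σ : Profile I) : ℕ → List (Cfg I)
  | 0 => [c0]
  | n + 1 => extend I σ (runH I c0 σ n)

/-- A run: the (possibly infinite) sequence of configurations of a maximal play. -/
abbrev Run (I : Interp Ag V F R) : Type := ℕ → Option (Cfg I)

/-- The unique maximal run determined by profile `σ` from initial configuration `c0`. -/
def runOf (I : Interp Ag V F R) (c0 : Cfg I) (σ : Profile I) : Run I :=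
  fun n => (runH I c0 σ n)[n]?

/-- `run(σ)` is finite (reaches the empty mechanism Λ). -/
def Terminates (I : Interp Ag V F R) (c0 : Cfg I) (σ : Profile I) : Prop :=
  ∃ n, ∃ s : State I, (runH I c0 σ n).getLast? = some ((none : Option (Mech Ag V F R)), s)

/-- The final state `s_σ` of a finite run. -/
def finalState (I : Interp Ag V F R) {c0 : Cfg I} {σ : Profile I}
    (h : Terminates I c0 σ) : State I :=
  h.choose_spec.choose

/-- An outcome function assigns an element of the domain to every terminal history
(represented by the corresponding run). -/
abbrev OutcomeF (I : Interp Ag V F R) : Type := Run I → I.D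

/-- An extended predicate (e-predicate): a set of pairs (state, outcome). -/
abbrev EPred (I : Interp Ag V F R) : Type := Set (State I × I.D)

/-- `ô ∈ Ô_Q`: every finite run is assigned an outcome satisfying `Q` at its final state. -/
def memOhat (I : Interp Ag V F R) (c0 : Cfg I) (Q : EPred I) (oh : OutcomeF I) : Prop :=
  ∀ σ : Profile I, ∀ ht : Terminates I c0 σ, (finalState I ht, oh (runOf I c0 σ)) ∈ Q

/-- `σ` is a Nash equilibrium in the game rooted at `c0` with outcome function `oh`. -/
def NashEq (I : Interp Ag V F R) (c0 : Cfg I) (oh : OutcomeF I) (σ : Profile I) : Prop :=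
  ∀ (i : Ag) (τ : Profile I), (∀ j, j ≠ i → τ j = σ j) →
    I.pref i (oh (runOf I c0 σ)) (oh (runOf I c0 τ))

/-- Prepend a finite sequence of configurations to a run. -/
def prependRun (I : Interp Ag V F R) (l : List (Cfg I)) (ρ : Run I) : Run I :=
  fun n => if hn : n < l.length then some l[n] else ρ (n - l.length)

/-- Restriction of an outcome function to the subgame reached via history `h`. -/
def restrictO (I : Interp Ag V F R) (h : List (Cfg I)) (oh : OutcomeF I) : OutcomeF I :=
  fun ρ => oh (prependRun I h.dropLast ρ)

/-- Restriction of a strategy profile to the subgame reached via history `h`. -/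
def restrictP (I : Interp Ag V F R) (h : List (Cfg I)) (σ : Profile I) : Profile I :=
  fun a h' => σ a (h.dropLast ++ h')

/-- `σ` is a subgame-perfect equilibrium in `G(γ,s,I,oh)`: its restriction to every
subgame (rooted at any configuration reachable from `⟨γ,s⟩`) is a Nash equilibrium there. -/
def SPE (I : Interp Ag V F R) (γ : Mech Ag V F R) (s : State I)
    (oh : OutcomeF I) (σ : Profile I) : Prop :=
  ∀ (h : List (Cfg I)) (c : Cfg I), IsHist I (some γ, s) h → h.getLast? = some c →
    NashEq I c (restrictO I h oh) (restrictP I h σ)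

/-- The correctness assertion `I ⊨ {P} γ {Q}`. -/
def Valid (I : Interp Ag V F R) (P : EPred I) (γ : Mech Ag V F R) (Q : EPred I) : Prop :=
  ∀ so ∈ P, ∃ (oh : OutcomeF I) (σ : Profile I),
    memOhat I (some γ, so.1) Q oh ∧ SPE I γ so.1 oh σ ∧ oh (runOf I (some γ, so.1) σ) = so.2

/-- The weakest precondition `wpre(γ,Q,I)`. -/
def wpre (I : Interp Ag V F R) (γ : Mech Ag V F R) (Q : EPred I) : EPred I :=
  {so | ∃ (oh : OutcomeF I) (σ : Profile I),
    memOhat I (some γ, so.1) Q oh ∧ SPE I γ so.1 oh σ ∧ oh (runOf I (some γ, so.1) σ) = so.2}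

/-- The substituted e-predicate `Q[x/t]`. -/
def substPred (I : Interp Ag V F R) (Q : EPred I) (x : V) (t : Term V F) : EPred I :=
  {so | (updState I so.1 x (t.eval I so.1), so.2) ∈ Q}

/-- `B^I ∩ P`. -/
def gate (I : Interp Ag V F R) (B : BExp V F R) (P : EPred I) : EPred I :=
  {so | so ∈ P ∧ B.holds I so.1}

/-- `(¬B)^I ∩ P`. -/
def gateN (I : Interp Ag V F R) (B : BExp V F R) (P : EPred I) : EPred I :=
  {so | so ∈ P ∧ ¬ B.holds I so.1}

/-- The Hoare-style calculus for mechanisms: `I ⊢ {P} γ {Q}`. -/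
inductive Deriv (I : Interp Ag V F R) : EPred I → Mech Ag V F R → EPred I → Prop where
  | assign (Q : EPred I) (x : V) (t : Term V F) :
      Deriv I (substPred I Q x t) (.assign x t) Q
  | choice (A : Finset Ag) (hA : A.Nonempty) (X : Ag → V) (hX : Set.InjOn X ↑A)
      (Q : EPred I) :
      Deriv I (wpre I (.choice A hA X hX) Q) (.choice A hA X hX) Q
  | comp {P R' Q : EPred I} {γ1 γ2 : Mech Ag V F R} :
      Deriv I P γ1 R' → Deriv I R' γ2 Q → Deriv I P (.seq γ1 γ2) Q
  | ifR {P Q : EPred I} {B : BExp V F R} {γ1 γ2 : Mech Ag V F R} :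
      Deriv I (gate I B P) γ1 Q → Deriv I (gateN I B P) γ2 Q →
      Deriv I P (.ite B γ1 γ2) Q
  | whileR {P : EPred I} {B : BExp V F R} {γ : Mech Ag V F R} :
      Deriv I (gate I B P) γ P → Deriv I P (.wh B γ) (gateN I B P)
  | conseq {P P' Q Q' : EPred I} {γ : Mech Ag V F R} :
      P ⊆ P' → Deriv I P' γ Q' → Q' ⊆ Q → Deriv I P γ Q

/-- The Nash-equilibrium variant of validity. -/
def NashValid (I : Interp Ag V F R) (P : EPred I) (γ : Mech Ag V F R) (Q : EPred I) : Prop :=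
  ∀ so ∈ P, ∃ (oh : OutcomeF I) (σ : Profile I),
    memOhat I (some γ, so.1) Q oh ∧ NashEq I (some γ, so.1) oh σ ∧
    oh (runOf I (some γ, so.1) σ) = so.2

/-- Mechanisms without any `ch_A` construct, i.e. ordinary programs (MPL(PRG)). -/
def ChoiceFree : Mech Ag V F R → Prop
  | .assign _ _ => True
  | .seq γ1 γ2 => ChoiceFree γ1 ∧ ChoiceFree γ2
  | .ite _ γ1 γ2 => ChoiceFree γ1 ∧ ChoiceFree γ2
  | .wh _ γ => ChoiceFree γ
  | .choice _ _ _ _ => False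

/-- Standard Hoare partial correctness: every finite maximal execution of `γ`
from a state in `P` terminates in a state in `Q`. -/
def HoarePartial (I : Interp Ag V F R) (P : Set (State I)) (γ : Mech Ag V F R)
    (Q : Set (State I)) : Prop :=
  ∀ s ∈ P, ∀ (h : List (Cfg I)) (t : State I),
    IsHist I (some γ, s) h → h.getLast? = some ((none : Option (Mech Ag V F R)), t) → t ∈ Q

end MPL

namespace MPL

variable {I : Interp Ag V F R}

/-! ### Continuing a history according to a profile -/

/-- The history obtained from `h` after `n` further steps of play according to `σ`. -/
def contH (I : Interp Ag V F R) (σ : Profile I) (h : List (Cfg I)) : ℕ → List (Cfg I)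
  | 0 => h
  | n + 1 => extend I σ (contH I σ h n)

/-- The maximal run that follows `h` and then continues according to `σ`. -/
def contRun (I : Interp Ag V F R) (σ : Profile I) (h : List (Cfg I)) : Run I :=
  fun n => (contH I σ h n)[n]?

theorem runH_eq_contH (c : Cfg I) (σ : Profile I) (n : ℕ) :
    runH I c σ n = contH I σ [c] n := by
  induction n with
  | zero => rfl
  | succ n ih => simp [runH, contH, ih]

theorem runOf_eq_contRun (c : Cfg I) (σ : Profile I) : runOf I c σ = contRun I σ [c] := by
  funext n
  simp [runOf, contRun, runH_eq_contH]

theorem extend_of_some {σ : Profile I} {h : List (Cfg I)} {γ : Mech Ag V F R} {s : State I}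
    (hl : h.getLast? = some (some γ, s)) : extend I σ h = h ++ [next I σ h γ s] := by
  simp [extend, hl]

theorem extend_of_none {σ : Profile I} {h : List (Cfg I)} {s : State I}
    (hl : h.getLast? = some (none, s)) : extend I σ h = h := by
  simp [extend, hl]

theorem extend_cases (σ : Profile I) (h : List (Cfg I)) :
    extend I σ h = h ∨
      ∃ γ s, h.getLast? = some (some γ, s) ∧ extend I σ h = h ++ [next I σ h γ s] := by
  rcases hl : h.getLast? with _ | ⟨_ | γ, s⟩
  · simp [extend, hl]
  · exact .inl (extend_of_none hl)
  · exact .inr ⟨γ, s, rfl, extend_of_some hl⟩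

theorem contH_add (σ : Profile I) (h : List (Cfg I)) (m n : ℕ) :
    contH I σ (contH I σ h m) n = contH I σ h (m + n) := by
  induction n with
  | zero => rfl
  | succ n ih => simp [contH, ih]

theorem contH_of_extend_eq {σ : Profile I} {h : List (Cfg I)} (hs : extend I σ h = h) (n : ℕ) :
    contH I σ h n = h := by
  induction n with
  | zero => rfl
  | succ n ih => simp [contH, ih, hs]

theorem prefix_extend (σ : Profile I) (h : List (Cfg I)) : h <+: extend I σ h := by
  rcases extend_cases σ h with e | ⟨γ, s, -, e⟩ <;> rw [e]
  exact List.prefix_append _ _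

theorem prefix_contH (σ : Profile I) (h : List (Cfg I)) (n : ℕ) : h <+: contH I σ h n := by
  induction n with
  | zero => exact List.prefix_rfl
  | succ n ih => exact ih.trans (prefix_extend _ _)

theorem contH_prefix_of_le (σ : Profile I) (h : List (Cfg I)) {m n : ℕ} (hmn : m ≤ n) :
    contH I σ h m <+: contH I σ h n := by
  obtain ⟨k, rfl⟩ := Nat.exists_eq_add_of_le hmn
  rw [← contH_add]
  exact prefix_contH _ _ _

theorem contH_ne_nil {σ : Profile I} {h : List (Cfg I)} (hh : h ≠ []) (n : ℕ) :
    contH I σ h n ≠ [] := by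
  intro e
  have := prefix_contH σ h n
  rw [e, List.prefix_nil] at this
  exact hh this

theorem _root_.List.IsPrefix.getElem?_eq_of_lt {α : Type*} {l l' : List α} (hp : l <+: l')
    {k : ℕ} (hk : k < l.length) : l[k]? = l'[k]? := by
  obtain ⟨e, rfl⟩ := hp
  rw [List.getElem?_append_left hk]

theorem length_contH_or_extend_eq (σ : Profile I) (h : List (Cfg I)) (n : ℕ) :
    (contH I σ h n).length = h.length + n ∨
      extend I σ (contH I σ h n) = contH I σ h n := by
  induction n with
  | zero => exact .inl rfl
  | succ n ih =>
    rcases ih with ih | ih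
    · rcases extend_cases σ (contH I σ h n) with e | ⟨γ, s, -, e⟩
      · right
        simp only [contH]
        rw [e, e]
      · left
        simp only [contH, e, List.length_append, ih, List.length_singleton]
        omega
    · right
      simp only [contH]
      rw [ih, ih]

theorem contRun_eq_of_extend_eq {σ : Profile I} {h : List (Cfg I)} {m : ℕ} (hh : h ≠ [])
    (hs : extend I σ (contH I σ h m) = contH I σ h m) (k : ℕ) :
    contRun I σ h k = (contH I σ h m)[k]? := by
  have hstab : ∀ n, m ≤ n → contH I σ h n = contH I σ h m := by
    intro n hmn
    obtain ⟨j, rfl⟩ := Nat.exists_eq_add_of_le hmn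
    rw [← contH_add, contH_of_extend_eq hs]
  rcases le_total m k with hk | hk
  · rw [contRun, hstab k hk]
  · have hlen := List.length_pos_of_ne_nil hh
    rcases length_contH_or_extend_eq σ h k with hl | hl
    · rw [contRun, (contH_prefix_of_le σ h hk).getElem?_eq_of_lt (by omega)]
    · obtain ⟨j, rfl⟩ := Nat.exists_eq_add_of_le hk
      rw [contRun, ← contH_add σ h k j, contH_of_extend_eq hl]

theorem contRun_eq_of_lt {σ : Profile I} {h : List (Cfg I)} {m k : ℕ} (hh : h ≠ [])
    (hk : k < (contH I σ h m).length) : contRun I σ h k = (contH I σ h m)[k]? := by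
  rcases length_contH_or_extend_eq σ h m with hl | hl
  · have hlen := List.length_pos_of_ne_nil hh
    rcases le_total m k with hmk | hkm
    · rw [contRun, ← (contH_prefix_of_le σ h hmk).getElem?_eq_of_lt hk]
    · rcases length_contH_or_extend_eq σ h k with hl' | hl'
      · rw [contRun, (contH_prefix_of_le σ h hkm).getElem?_eq_of_lt (by omega)]
      · obtain ⟨j, rfl⟩ := Nat.exists_eq_add_of_le hkm
        rw [contRun, ← contH_add σ h k j, contH_of_extend_eq hl']
  · exact contRun_eq_of_extend_eq hh hl k

theorem contRun_contH {σ : Profile I} {h : List (Cfg I)} (hh : h ≠ []) (m : ℕ) :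
    contRun I σ (contH I σ h m) = contRun I σ h := by
  funext k
  have hlen := List.length_pos_of_ne_nil hh
  rcases length_contH_or_extend_eq σ h (m + k) with hl | hl
  · rw [contRun, contH_add, contRun_eq_of_lt hh (m := m + k) (by omega)]
  · rw [contRun, contH_add, contRun_eq_of_extend_eq hh hl]

theorem next_congr {σ τ : Profile I} {h h' : List (Cfg I)} (hst : ∀ a, σ a h = τ a h')
    (γ : Mech Ag V F R) (s : State I) : next I σ h γ s = next I τ h' γ s := by
  induction γ generalizing s with
  | choice A hA X hX =>
    unfold next
    congr 1
    funext y
    simp only [chooseVal, hst]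
  | seq γ1 γ2 ih1 ih2 => simp only [next, ih1]
  | _ => rfl

theorem extend_congr {σ τ : Profile I} {h : List (Cfg I)} (hst : ∀ a, σ a h = τ a h) :
    extend I σ h = extend I τ h := by
  unfold extend
  split
  · rw [next_congr hst]
  · rfl

theorem contH_congr {σ τ : Profile I} {h : List (Cfg I)} {n : ℕ}
    (hst : ∀ k < n, ∀ a, σ a (contH I σ h k) = τ a (contH I σ h k)) :
    contH I σ h n = contH I τ h n := by
  induction n with
  | zero => rfl
  | succ n ih =>
    have e := ih fun k hk => hst k (by omega)
    simp only [contH]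
    rw [← e]
    exact extend_congr (hst n (by omega))

theorem contRun_congr {σ τ : Profile I} {h : List (Cfg I)}
    (hst : ∀ h', h <+: h' → ∀ a, σ a h' = τ a h') : contRun I σ h = contRun I τ h := by
  funext n
  rw [contRun, contRun, contH_congr fun k _ => hst _ (prefix_contH _ _ _)]

theorem dropLast_append_of_getLast? {α : Type*} {l : List α} {c : α}
    (hl : l.getLast? = some c) : l.dropLast ++ [c] = l := by
  obtain ⟨d, rfl⟩ := List.getLast?_eq_some_iff.1 hl
  simp

theorem extend_append (σ : Profile I) (d : List (Cfg I)) {h : List (Cfg I)} (hh : h ≠ []) :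
    extend I σ (d ++ h) = d ++ extend I (fun a h' => σ a (d ++ h')) h := by
  obtain ⟨e, c, rfl⟩ := List.eq_nil_or_concat' h |>.resolve_left hh
  rcases c with ⟨_ | γ, s⟩
  · rw [extend_of_none (s := s) (by simp), extend_of_none (s := s) (by simp)]
  · rw [extend_of_some (γ := γ) (s := s) (by simp), extend_of_some (γ := γ) (s := s) (by simp),
      next_congr (σ := fun a h' => σ a (d ++ h')) (τ := σ) (fun a => rfl)]
    simp

theorem contH_eq_append_runH {h : List (Cfg I)} {c : Cfg I} (hl : h.getLast? = some c)
    (σ : Profile I) (n : ℕ) :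
    contH I σ h n = h.dropLast ++ runH I c (restrictP I h σ) n := by
  induction n with
  | zero => simp [contH, runH, dropLast_append_of_getLast? hl]
  | succ n ih =>
    simp only [contH, runH, ih]
    rw [extend_append]
    · rfl
    · rw [runH_eq_contH]
      exact contH_ne_nil (by simp) n

theorem prependRun_runOf {h : List (Cfg I)} {c : Cfg I} (hl : h.getLast? = some c)
    (σ : Profile I) :
    prependRun I h.dropLast (runOf I c (restrictP I h σ)) = contRun I σ h := by
  have hh : h ≠ [] := by rintro rfl; simp at hl
  have hlen := List.length_pos_of_ne_nil hh
  funext n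
  by_cases hn : n < h.dropLast.length
  · have hn' : n < h.length := by simp at hn; omega
    rw [contRun_eq_of_lt hh (m := 0) hn']
    simp only [prependRun, hn, dif_pos, contH]
    simp [List.getElem_dropLast, hn']
  · obtain ⟨m, rfl⟩ := Nat.exists_eq_add_of_le (not_lt.1 hn)
    have e : prependRun I h.dropLast (runOf I c (restrictP I h σ)) (h.dropLast.length + m)
        = (contH I σ h m)[h.dropLast.length + m]? := by
      rw [contH_eq_append_runH hl, prependRun, dif_neg hn,
        List.getElem?_append_right (by omega)]
      simp [runOf]
    rw [e]
    rcases length_contH_or_extend_eq σ h m with hm | hm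
    · rw [contRun_eq_of_lt hh]
      rw [hm, List.length_dropLast]
      omega
    · rw [contRun_eq_of_extend_eq hh hm]

/-! ### Equilibria and outcome functions in terms of continuations -/

theorem SPE_iff {γ : Mech Ag V F R} {s : State I} {oh : OutcomeF I} {σ : Profile I} :
    SPE I γ s oh σ ↔ ∀ h, IsHist I (some γ, s) h → ∀ (i : Ag) (τ : Profile I),
      (∀ j, j ≠ i → τ j = σ j) → I.pref i (oh (contRun I σ h)) (oh (contRun I τ h)) := by
  constructor
  · intro H h hh i τ hτ
    obtain ⟨c, hc⟩ : ∃ c, h.getLast? = some c := by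
      cases h with
      | nil => simp [IsHist] at hh
      | cons a l => exact ⟨_, List.getLast?_eq_some_getLast (by simp)⟩
    have := H h c hh hc i (restrictP I h τ) fun j hj => by funext h'; simp [restrictP, hτ j hj]
    simpa [restrictO, prependRun_runOf hc] using this
  · intro H h c hh hc i τ hτ
    let τ' : Profile I := fun a h' =>
      if h.dropLast <+: h' then τ a (h'.drop h.dropLast.length) else σ a h'
    have hr : restrictP I h τ' = τ := by
      funext a h'
      simp [restrictP, τ', -List.length_dropLast]
    have := H h hh i τ' fun j hj => by
      funext h'
      simp only [τ']
      split_ifs with hp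
      · obtain ⟨e, rfl⟩ := hp
        simp [hτ j hj, restrictP, -List.length_dropLast]
      · rfl
    rw [← prependRun_runOf hc, ← prependRun_runOf hc, hr] at this
    exact this

theorem memOhat_iff {c : Cfg I} {Q : EPred I} {oh : OutcomeF I} :
    memOhat I c Q oh ↔ ∀ (σ : Profile I) (n : ℕ) (t : State I),
      (contH I σ [c] n).getLast? = some (none, t) → (t, oh (contRun I σ [c])) ∈ Q := by
  constructor
  · intro H σ n t hn
    have ht : Terminates I c σ := ⟨n, t, by rw [runH_eq_contH, hn]⟩
    have h1 := H σ ht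
    have h2 := ht.choose_spec.choose_spec
    rw [runOf_eq_contRun] at h1
    change (runH I c σ ht.choose).getLast? = some (none, finalState I ht) at h2
    rw [runH_eq_contH] at h2
    suffices finalState I ht = t by rwa [this] at h1
    have key : ∀ {m k : ℕ} {u v : State I}, m ≤ k →
        (contH I σ [c] m).getLast? = some (none, u) →
        (contH I σ [c] k).getLast? = some (none, v) → u = v := by
      intro m k u v hmk hu hv
      obtain ⟨j, rfl⟩ := Nat.exists_eq_add_of_le hmk
      rw [← contH_add, contH_of_extend_eq (extend_of_none hu), hu] at hv
      simpa using hv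
    rcases le_total ht.choose n with hle | hle
    · exact key hle h2 hn
    · exact (key hle hn h2).symm
  · intro H σ ht
    have h2 := ht.choose_spec.choose_spec
    change (runH I c σ ht.choose).getLast? = some (none, finalState I ht) at h2
    rw [runH_eq_contH] at h2
    rw [runOf_eq_contRun]
    exact H σ _ _ h2

theorem exists_step_next (σ : Profile I) (h : List (Cfg I)) (γ : Mech Ag V F R) (s : State I) :
    ∃ L, Step I (some γ, s) L (next I σ h γ s) := by
  induction γ generalizing s with
  | assign x t => exact ⟨_, .assign x t s⟩
  | choice A hA X hX =>
    refine ⟨_, .choice A hA X hX s _ fun y hy => ?_⟩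
    rw [chooseVal, dif_neg]
    rintro ⟨a, ha, rfl⟩
    exact hy a ha rfl
  | seq γ1 γ2 ih1 ih2 =>
    obtain ⟨L, hL⟩ := ih1 s
    refine ⟨L, ?_⟩
    rcases hn : next I σ h γ1 s with ⟨_ | γ', s'⟩ <;> rw [hn] at hL <;> simp only [next, hn]
    · exact .seqFin hL
    · exact .seqStep hL
  | ite B γ1 γ2 ih1 ih2 =>
    by_cases hB : B.holds I s <;> simp only [next, hB, if_true, if_false]
    · exact ⟨_, .iteT hB⟩
    · exact ⟨_, .iteF hB⟩
  | wh B γ ih =>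
    by_cases hB : B.holds I s <;> simp only [next, hB, if_true, if_false]
    · exact ⟨_, .whT hB⟩
    · exact ⟨_, .whF hB⟩

theorem IsHist.contH {c : Cfg I} {h : List (Cfg I)} (hh : IsHist I c h) (σ : Profile I) (n : ℕ) :
    IsHist I c (contH I σ h n) := by
  induction n with
  | zero => exact hh
  | succ n ih =>
    rw [MPL.contH]
    rcases extend_cases σ (MPL.contH I σ h n) with e | ⟨γ, s, hl, e⟩ <;> rw [e]
    · exact ih
    · refine ⟨by simp [List.head?_append, ih.1], ?_⟩
      refine List.isChain_append.2 ⟨ih.2, List.isChain_singleton _, ?_⟩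
      intro x hx y hy
      rw [hl] at hx
      simp only [Option.mem_def, Option.some.injEq, List.head?_cons] at hx hy
      subst hx hy
      exact exists_step_next _ _ _ _

theorem isHist_singleton (c : Cfg I) : IsHist I c [c] := ⟨rfl, List.isChain_singleton _⟩

theorem prependRun_append (l l' : List (Cfg I)) (ρ : Run I) :
    prependRun I (l ++ l') ρ = prependRun I l (prependRun I l' ρ) := by
  funext n
  simp only [prependRun, List.length_append]
  by_cases h1 : n < l.length
  · simp [h1, Nat.lt_add_right]
  · by_cases h2 : n < l.length + l'.length
    · have h3 : n - l.length < l'.length := by omega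
      simp [h1, h2, h3, List.getElem_append_right (not_lt.1 h1)]
    · have h3 : ¬ n - l.length < l'.length := by omega
      simp [h1, h2, h3, Nat.sub_sub]

/-- The restriction of an equilibrium to a reachable subgame witnesses membership in the
weakest precondition of the remaining mechanism. -/
theorem mem_wpre_of_contH {γ γ' : Mech Ag V F R} {s t : State I} {Q : EPred I}
    {oh : OutcomeF I} {σ τ : Profile I} {n : ℕ} (hQ : memOhat I (some γ, s) Q oh)
    (hσ : SPE I γ s oh σ)
    (hl : (contH I τ [(some γ, s)] n).getLast? = some (some γ', t)) :
    (t, oh (contRun I σ (contH I τ [(some γ, s)] n))) ∈ wpre I γ' Q := by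
  set K := contH I τ [(some γ, s)] n with hK
  have hKh : IsHist I (some γ, s) K := (isHist_singleton _).contH τ n
  have hKd := dropLast_append_of_getLast? hl
  refine ⟨restrictO I K oh, restrictP I K σ, ?_, ?_, ?_⟩
  · rw [memOhat_iff] at hQ ⊢
    intro ρ m u hu
    let τ' : Profile I := fun a h => if K <+: h then ρ a (h.drop K.dropLast.length) else τ a h
    have hτ' : ∀ k ≤ n, contH I τ' [(some γ, s)] k = contH I τ [(some γ, s)] k := by
      intro k hk
      refine (contH_congr fun j hj a => ?_).symm
      have : ¬ K <+: contH I τ [(some γ, s)] j := by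
        intro hp
        have hlen : K.length ≤ _ := hp.length_le
        have hj1 : contH I τ [(some γ, s)] (j + 1) <+: K := contH_prefix_of_le _ _ (by omega)
        have hjK := (prefix_extend τ (contH I τ [(some γ, s)] j)).trans hj1
        have heq := hjK.eq_of_length_le hlen
        rw [contH, heq, extend_of_some hl] at hj1
        simpa using hj1.length_le
      simp [τ', this]
    have hKτ : contH I τ' [(some γ, s)] n = K := hτ' n le_rfl
    let ρ' : Profile I := fun a h => ρ a (h.drop K.dropLast.length)
    have hpref : ∀ h', K <+: h' → ∀ a, τ' a h' = ρ' a h' := by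
      intro h' hp a
      simp [τ', ρ', hp]
    have hrest : restrictP I K ρ' = ρ := by
      funext a h
      simp [restrictP, ρ', -List.length_dropLast]
    have hrun : contRun I τ' [(some γ, s)] = prependRun I K.dropLast (runOf I (some γ', t) ρ) := by
      rw [← contRun_contH (by simp) n, hKτ, contRun_congr hpref, ← prependRun_runOf hl, hrest]
    have hend : (contH I τ' [(some γ, s)] (n + m)).getLast? = some (none, u) := by
      rw [← contH_add, hKτ, contH_congr (fun k _ => hpref _ (prefix_contH _ _ _)),
        contH_eq_append_runH hl, hrest, runH_eq_contH, List.getLast?_append, hu]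
      rfl
    have := hQ τ' _ _ hend
    rwa [hrun, runOf_eq_contRun] at this
  · intro h c hh hc
    have hne : h ≠ [] := by rintro rfl; simp at hc
    have hist : IsHist I (some γ, s) (K.dropLast ++ h) := by
      obtain ⟨hhd, hch⟩ := hh
      cases h with
      | nil => simp at hne
      | cons b l =>
        simp only [List.head?_cons, Option.some.injEq] at hhd
        subst hhd
        have hK2 := hKh.2
        have hK1 := hKh.1
        rw [← hKd] at hK1 hK2
        refine ⟨?_, ?_⟩
        · rw [List.head?_append] at hK1 ⊢
          exact hK1
        · have h3 := List.isChain_append.1 hK2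
          exact List.isChain_append.2 ⟨h3.1, hch, h3.2.2⟩
    have key := hσ (K.dropLast ++ h) c hist (by rw [List.getLast?_append, hc]; rfl)
    have e1 : restrictO I (K.dropLast ++ h) oh = restrictO I h (restrictO I K oh) := by
      funext ρ
      simp only [restrictO]
      rw [List.dropLast_append_of_ne_nil hne, prependRun_append]
    have e2 : restrictP I (K.dropLast ++ h) σ = restrictP I h (restrictP I K σ) := by
      funext a h'
      simp only [restrictP]
      rw [List.dropLast_append_of_ne_nil hne, List.append_assoc]
    rwa [e1, e2] at key
  · exact congrArg oh (prependRun_runOf hl σ)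

/-! ### Lifting plays of `γ1` to plays of `γ1; γ2` -/

/-- The configuration of `γ1; γ2` that corresponds to a configuration of `γ1`. -/
def liftCfg (γ2 : Mech Ag V F R) : Cfg I → Cfg I
  | (none, s) => (some γ2, s)
  | (some γ, s) => (some (.seq γ γ2), s)

theorem liftCfg_injective (γ2 : Mech Ag V F R) : Function.Injective (liftCfg (I := I) γ2) := by
  have hne : ∀ γ : Mech Ag V F R, γ2 ≠ .seq γ γ2 := fun γ e => by
    have := congrArg sizeOf e
    simp at this
  rintro ⟨_ | γ, s⟩ ⟨_ | γ', s'⟩ e <;> simp only [liftCfg, Prod.mk.injEq, Option.some.injEq] at e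
  · simp [e.2]
  · exact absurd e.1 (hne _)
  · exact absurd e.1.symm (hne _)
  · obtain ⟨e1, e2⟩ := e
    injection e1 with e1
    simp [e1, e2]

theorem next_seq (σ : Profile I) (h : List (Cfg I)) (γ γ2 : Mech Ag V F R) (s : State I) :
    next I σ h (.seq γ γ2) s = liftCfg γ2 (next I σ h γ s) := by
  rcases hn : next I σ h γ s with ⟨_ | γ', s'⟩ <;> simp [next, hn, liftCfg]

theorem Step.lift {γ2 : Mech Ag V F R} {c c' : Cfg I} {L : Set Ag} (hs : Step I c L c') :
    Step I (liftCfg γ2 c) L (liftCfg γ2 c') := by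
  rcases c with ⟨_ | γ, s⟩
  · cases hs
  · rcases c' with ⟨_ | γ', s'⟩
    · exact .seqFin hs
    · exact .seqStep hs

theorem IsHist.lift {γ2 : Mech Ag V F R} {c : Cfg I} {h : List (Cfg I)} (hh : IsHist I c h) :
    IsHist I (liftCfg γ2 c) (h.map (liftCfg γ2)) := by
  refine ⟨by simp [hh.1], ?_⟩
  refine (List.isChain_map _).2 (hh.2.imp ?_)
  rintro a b ⟨L, hL⟩
  exact ⟨L, hL.lift⟩

/-- No configuration of the history is terminal. -/
def Live (h : List (Cfg I)) : Prop := ∀ c ∈ h, c.1 ≠ none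

theorem IsHist.live_or_terminal {c : Cfg I} {h : List (Cfg I)} (hh : IsHist I c h) :
    Live h ∨ ∃ t, h.getLast? = some (none, t) := by
  obtain ⟨-, hc⟩ := hh
  induction h using List.reverseRecOn with
  | nil => exact .inl (by simp [Live])
  | append_singleton l b ih =>
    have h3 := List.isChain_append.1 hc
    have hl : Live l := by
      refine (ih h3.1).resolve_right ?_
      rintro ⟨t, ht⟩
      obtain ⟨L, hL⟩ := h3.2.2 _ ht b (by simp)
      cases hL
    rcases b with ⟨_ | γ, s⟩
    · exact .inr ⟨s, by simp⟩
    · left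
      intro x hx
      rcases List.mem_append.1 hx with hx | hx
      · exact hl x hx
      · simp only [List.mem_singleton] at hx
        simp [hx]

/-- The profile that `σ` induces on histories of `γ1`. -/
def unliftP (γ2 : Mech Ag V F R) (σ : Profile I) : Profile I :=
  fun a h => σ a (h.map (liftCfg γ2))

/-- The profile for `γ1; γ2` that plays `τ` while `γ1` is running and `σ` afterwards. -/
def liftP (γ2 : Mech Ag V F R) (σ τ : Profile I) : Profile I :=
  fun a h => if hh : ∃ l, Live l ∧ h = l.map (liftCfg γ2) then τ a hh.choose else σ a h

theorem liftP_map {γ2 : Mech Ag V F R} {σ τ : Profile I} {h : List (Cfg I)} (hh : Live h)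
    (a : Ag) : liftP γ2 σ τ a (h.map (liftCfg γ2)) = τ a h := by
  have hex : ∃ l, Live l ∧ h.map (liftCfg γ2) = l.map (liftCfg γ2) := ⟨h, hh, rfl⟩
  rw [liftP, dif_pos hex, ← (liftCfg_injective γ2).list_map hex.choose_spec.2]

theorem liftP_eq_of_agree {γ2 : Mech Ag V F R} {σ τ : Profile I} {a : Ag}
    (hτ : τ a = unliftP γ2 σ a) : liftP γ2 σ τ a = σ a := by
  funext h
  rw [liftP]
  split_ifs with hex
  · rw [hτ, unliftP, ← hex.choose_spec.2]
  · rfl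

theorem liftP_of_prefix {γ2 : Mech Ag V F R} {σ τ : Profile I} {h h' : List (Cfg I)}
    (hh : ¬ Live h) (hp : h.map (liftCfg γ2) <+: h') (a : Ag) : liftP γ2 σ τ a h' = σ a h' := by
  rw [liftP, dif_neg]
  rintro ⟨l, hl, rfl⟩
  have : h <+: l := (List.prefix_map_iff_of_injective (liftCfg_injective γ2)).1 hp
  exact hh fun c hc => hl c (this.subset hc)

theorem extend_liftP {γ2 : Mech Ag V F R} {σ τ : Profile I} {h : List (Cfg I)} (hh : Live h) :
    extend I (liftP γ2 σ τ) (h.map (liftCfg γ2)) = (extend I τ h).map (liftCfg γ2) := by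
  rcases List.eq_nil_or_concat' h with rfl | ⟨l, ⟨_ | γ, s⟩, rfl⟩
  · simp [extend]
  · exact absurd rfl (hh (none, s) (by simp))
  · rw [extend_of_some (h := l ++ [(some γ, s)]) (γ := γ) (s := s) (by simp),
      extend_of_some (γ := .seq γ γ2) (s := s) (by simp [liftCfg]), next_seq,
      next_congr (τ := τ) (h' := l ++ [(some γ, s)]) (liftP_map hh)]
    simp

theorem contH_liftP {γ2 : Mech Ag V F R} {σ τ : Profile I} {h : List (Cfg I)} {n : ℕ}
    (hh : ∀ k < n, Live (contH I τ h k)) :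
    contH I (liftP γ2 σ τ) (h.map (liftCfg γ2)) n = (contH I τ h n).map (liftCfg γ2) := by
  induction n with
  | zero => rfl
  | succ n ih =>
    simp only [contH]
    rw [ih fun k hk => hh k (by omega), extend_liftP (hh n (by omega))]

/-- The run of `γ1; γ2` that corresponds to a run of `γ1`: after termination of `γ1` it
continues according to `σ`. -/
def liftRun (γ2 : Mech Ag V F R) (σ : Profile I) (ρ : Run I) : Run I :=
  if hH : ∃ H : List (Cfg I), (∀ k, ρ k = H[k]?) then
    contRun I σ (hH.choose.map (liftCfg γ2))
  else fun n => (ρ n).map (liftCfg γ2)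

theorem liftRun_of_list {γ2 : Mech Ag V F R} {σ : Profile I} {ρ : Run I} {H : List (Cfg I)}
    (hH : ∀ k, ρ k = H[k]?) : liftRun γ2 σ ρ = contRun I σ (H.map (liftCfg γ2)) := by
  have hex : ∃ H : List (Cfg I), ∀ k, ρ k = H[k]? := ⟨H, hH⟩
  have e : hex.choose = H := List.ext_getElem? fun k => by
    rw [← hex.choose_spec k, hH k]
  rw [liftRun, dif_pos hex, e]

theorem exists_contH_liftP_of_terminal {γ2 : Mech Ag V F R} {σ τ : Profile I} {c : Cfg I}
    {h : List (Cfg I)} (hist : IsHist I c h) {n : ℕ} {t : State I}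
    (ht : (contH I τ h n).getLast? = some (none, t)) :
    ∃ N, contH I (liftP γ2 σ τ) (h.map (liftCfg γ2)) N = (contH I τ h n).map (liftCfg γ2) := by
  have hex : ∃ N, ¬ Live (contH I τ h N) :=
    ⟨n, fun hl => hl (none, t) (List.mem_of_getLast? ht) rfl⟩
  refine ⟨Nat.find hex, ?_⟩
  have hN := Nat.find_spec hex
  have hle : Nat.find hex ≤ n :=
    Nat.find_min' hex fun hl => hl (none, t) (List.mem_of_getLast? ht) rfl
  rw [contH_liftP fun k hk => not_not.1 (Nat.find_min hex hk)]
  obtain ⟨u, hu⟩ := ((hist.contH τ _).live_or_terminal).resolve_left hN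
  obtain ⟨j, hj⟩ := Nat.exists_eq_add_of_le hle
  conv_rhs => rw [hj, ← contH_add, contH_of_extend_eq (extend_of_none hu)]

theorem liftRun_contRun {γ2 : Mech Ag V F R} {σ τ : Profile I} {c : Cfg I} {h : List (Cfg I)}
    (hist : IsHist I c h) (hh : Live h) :
    liftRun γ2 σ (contRun I τ h) = contRun I (liftP γ2 σ τ) (h.map (liftCfg γ2)) := by
  have hne : h ≠ [] := by rintro rfl; simp [IsHist] at hist
  have hne' : h.map (liftCfg γ2) ≠ [] := by simpa using hne
  by_cases hex : ∃ n t, (contH I τ h n).getLast? = some (none, t)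
  · obtain ⟨n, t, ht⟩ := hex
    obtain ⟨N, hN⟩ := exists_contH_liftP_of_terminal (γ2 := γ2) (σ := σ) hist ht
    rw [liftRun_of_list (contRun_eq_of_extend_eq hne (extend_of_none ht)),
      ← contRun_contH hne' N, hN]
    refine (contRun_congr fun h' hp a => liftP_of_prefix (fun hl => ?_) hp a).symm
    exact hl (none, t) (List.mem_of_getLast? ht) rfl
  · have hlive : ∀ n, Live (contH I τ h n) := fun n =>
      ((hist.contH τ n).live_or_terminal).resolve_right fun ⟨t, ht⟩ => hex ⟨n, t, ht⟩
    have hlen : ∀ n, n < (contH I τ h n).length := by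
      intro n
      rcases length_contH_or_extend_eq τ h n with hl | hl
      · have := List.length_pos_of_ne_nil hne
        omega
      · exfalso
        obtain ⟨l, ⟨_ | γ, s⟩, hlc⟩ :=
          (List.eq_nil_or_concat' (contH I τ h n)).resolve_left (contH_ne_nil hne n)
        · exact hlive n (none, s) (by simp [hlc]) rfl
        · rw [extend_of_some (γ := γ) (s := s) (by simp [hlc])] at hl
          simp at hl
    rw [liftRun, dif_neg]
    · funext n
      rw [contRun, contRun, contH_liftP fun k _ => hlive k, List.getElem?_map]
    · rintro ⟨H, hH⟩
      have h1 := hH H.length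
      rw [contRun, List.getElem?_eq_getElem (hlen _)] at h1
      simp at h1

theorem valid_wpre_of_valid_seq {γ1 γ2 : Mech Ag V F R} {P Q : EPred I}
    (h : Valid I P (Mech.seq γ1 γ2) Q) : Valid I P γ1 (wpre I γ2 Q) := by
  rintro ⟨s, o⟩ hso
  obtain ⟨oh, σ, hQ, hσ, ho⟩ := h _ hso
  have hlive : Live [((some γ1, s) : Cfg I)] := by simp [Live]
  have hself : liftP γ2 σ (unliftP γ2 σ) = σ := funext fun a => liftP_eq_of_agree rfl
  refine ⟨fun ρ => oh (liftRun γ2 σ ρ), unliftP γ2 σ, ?_, ?_, ?_⟩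
  · rw [memOhat_iff]
    intro τ n t ht
    obtain ⟨N, hN⟩ := exists_contH_liftP_of_terminal (γ2 := γ2) (σ := σ) (isHist_singleton _) ht
    change contH I (liftP γ2 σ τ) [(some (.seq γ1 γ2), s)] N = _ at hN
    have hl : (contH I (liftP γ2 σ τ) [(some (.seq γ1 γ2), s)] N).getLast? =
        some (some γ2, t) := by
      rw [hN, List.getLast?_map, ht]
      rfl
    have := mem_wpre_of_contH hQ hσ hl
    rwa [hN, ← liftRun_of_list (contRun_eq_of_extend_eq (by simp) (extend_of_none ht))] at this
  · rw [SPE_iff] at hσ ⊢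
    intro k hk i τ hτ
    rcases hk.live_or_terminal with hl | ⟨t, ht⟩
    · rw [liftRun_contRun hk hl, liftRun_contRun hk hl, hself]
      exact hσ _ hk.lift i _ fun j hj => liftP_eq_of_agree (hτ j hj)
    · have e : contRun I (unliftP γ2 σ) k = contRun I τ k := by
        funext n
        rw [contRun, contRun, contH_of_extend_eq (extend_of_none ht),
          contH_of_extend_eq (extend_of_none ht)]
      rw [e]
      exact I.pref_refl _ _
  · rw [runOf_eq_contRun] at ho ⊢
    change oh (liftRun γ2 σ (contRun I (unliftP γ2 σ) [(some γ1, s)])) = o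
    rw [liftRun_contRun (isHist_singleton _) hlive, hself]
    exact ho

end MPL

open MPL in
/-- Decomposition Lemma: if `I ⊨ {P}γ1;γ2{Q}` then there is an e-predicate `R` with
`I ⊨ {P}γ1{R}` and `I ⊨ {R}γ2{Q}`; indeed `R = wpre(γ2,Q,I)` has this property. -/
theorem decomposition_lemma {Ag V F R : Type} (I : Interp Ag V F R)
    (γ1 γ2 : Mech Ag V F R) (P Q : EPred I)
    (h : Valid I P (Mech.seq γ1 γ2) Q) :
    (∃ R' : EPred I, Valid I P γ1 R' ∧ Valid I R' γ2 Q) ∧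
    Valid I P γ1 (wpre I γ2 Q) ∧ Valid I (wpre I γ2 Q) γ2 Q := by
  exact ⟨⟨wpre I γ2 Q, valid_wpre_of_valid_seq h, fun _ hso => hso⟩,
    valid_wpre_of_valid_seq h, fun _ hso => hso⟩
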